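/- arXiv:0708.1232 — 4 statements merged into one kernel-verified Lean document; each statement's English description precedes it below -/
import Mathlib

section
/- For all natural numbers n ≥ 1 and all k with 1 ≤ k ≤ n, the Eulerian number satisfies the recursion A(n,k) = (n−k+1)·A(n−1,k−1) + (k+1)·A(n−1,k); moreover A(n,0) = A(n−1,0) and A(0,0) = 1. Here A(n,k) is defined as a cardinality of a set of permutations, so this recursion is a theorem about counting permutations by their number of rises. -/
/-- Number of rises of a list: indices `i` with `l[i] < l[i+1]`. -/
def listRises (l : List ℕ) : ℕ :=
  ((l.zip l.tail).filter fun p => p.1 < p.2).length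

/-- Number of rises of a permutation of `Fin m`, viewed as the sequence
`σ 0, σ 1, …, σ (m-1)`. -/
def permRises {m : ℕ} (σ : Equiv.Perm (Fin m)) : ℕ :=
  listRises (List.ofFn fun i => (σ i : ℕ))

/-- The Eulerian number `A(n,k)`: the number of permutations of `Fin (n+1)`
with exactly `k` rises. -/
def eulerian (n k : ℕ) : ℕ :=
  (Finset.univ.filter fun σ : Equiv.Perm (Fin (n+1)) => permRises σ = k).card

theorem listRises_cons_cons (a b : ℕ) (l : List ℕ) :
    listRises (a :: b :: l) = (if a < b then 1 else 0) + listRises (b :: l) := by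
  unfold listRises
  by_cases h : a < b <;> simp [List.filter_cons, h, Nat.add_comm]

theorem listRises_le (l : List ℕ) : listRises l ≤ l.length := by
  unfold listRises
  refine (List.length_filter_le _ _).trans ?_
  simp

theorem listRises_insert (M : ℕ) (g : ℕ → ℕ) (a : ℕ) (l : List ℕ)
    (h : ∀ x ∈ a :: l, x < M) :
    ∑ p ∈ Finset.range ((a :: l).length + 1), g (listRises ((a :: l).insertIdx p M)) =
      (listRises (a :: l) + 1) * g (listRises (a :: l)) +
        ((a :: l).length - listRises (a :: l)) * g (listRises (a :: l) + 1) := by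
  induction l generalizing a g with
  | nil =>
    have ha : a < M := h a (by simp)
    have ha' : ¬ M < a := by omega
    simp [Finset.sum_range_succ, listRises, ha, ha']
  | cons b t ih =>
    have ha : a < M := h a (by simp)
    have hb : b < M := h b (by simp)
    have ha' : ¬ M < a := by omega
    have hb' : ¬ M < b := by omega
    have hle := listRises_le (b :: t)
    have IH := ih (fun x => g ((if a < b then 1 else 0) + x)) b
      (fun x hx => h x (List.mem_cons_of_mem _ hx))
    rw [Finset.sum_range_succ'] at IH
    rw [List.length_cons, Finset.sum_range_succ', List.length_cons, Finset.sum_range_succ']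
    simp only [List.insertIdx_succ_cons, List.insertIdx_zero, listRises_cons_cons,
      List.length_cons, ha, ha', hb', if_true, if_false, Nat.zero_add, zero_add] at IH hle ⊢
    set r := listRises (b :: t)
    obtain ⟨d, hd⟩ := Nat.exists_eq_add_of_le hle
    split_ifs at IH ⊢ with hab
    · rw [hd] at IH ⊢
      have e1 : r + d + 1 - (1 + r) = d := by omega
      have e2 : r + d - r = d := by omega
      rw [e1]
      rw [e2] at IH
      rw [show 1 + (r + 1) = 1 + r + 1 by ring] at IH
      linear_combination IH
    · rw [hd] at IH ⊢
      simp only [Nat.zero_add, zero_add] at IH ⊢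
      have e1 : r + d + 1 - r = d + 1 := by omega
      have e2 : r + d - r = d := by omega
      rw [e1]
      rw [e2] at IH
      rw [show 1 + r = r + 1 by ring]
      linear_combination IH

/-- Insert the maximal value at position `p`. -/
def insMax (n : ℕ) (x : Fin (n+1) × Equiv.Perm (Fin n)) : Equiv.Perm (Fin (n+1)) :=
  ((finSuccEquiv' x.1).trans (Equiv.optionCongr x.2)).trans (finSuccEquiv' (Fin.last n)).symm

theorem insMax_self (n : ℕ) (p : Fin (n+1)) (e : Equiv.Perm (Fin n)) :
    insMax n (p, e) p = Fin.last n := by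
  simp [insMax]

theorem insMax_succAbove (n : ℕ) (p : Fin (n+1)) (e : Equiv.Perm (Fin n)) (i : Fin n) :
    insMax n (p, e) (p.succAbove i) = (e i).castSucc := by
  simp [insMax]

theorem insMax_bijective (n : ℕ) : Function.Bijective (insMax n) := by
  rw [Fintype.bijective_iff_injective_and_card]
  constructor
  · rintro ⟨p, e⟩ ⟨q, f⟩ h
    have hpq : p = q := by
      apply (insMax n (q, f)).injective
      rw [insMax_self, ← h, insMax_self]
    subst hpq
    congr 1
    ext i
    have := insMax_succAbove n p e i
    rw [h, insMax_succAbove] at this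
    exact congrArg Fin.val (Fin.castSucc_injective _ this).symm
  · simp [Fintype.card_perm, Nat.factorial_succ]

theorem ofFn_insMax (n : ℕ) (p : Fin (n+1)) (e : Equiv.Perm (Fin n)) :
    (List.ofFn fun i => (insMax n (p, e) i : ℕ)) =
      (List.ofFn fun i => (e i : ℕ)).insertIdx p n := by
  have hp := p.isLt
  have hlen : (List.ofFn fun i => (insMax n (p, e) i : ℕ)).length =
      ((List.ofFn fun i => (e i : ℕ)).insertIdx p n).length := by
    rw [List.length_insertIdx_of_le_length (by simp; omega)]; simp
  refine List.ext_getElem hlen ?_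
  intro i h1 h2
  have hi : i < n + 1 := by simpa using h1
  rw [List.getElem_ofFn, List.getElem_insertIdx]
  split_ifs with h3 h4
  · have := insMax_succAbove n p e ⟨i, by omega⟩
    rw [Fin.succAbove_of_castSucc_lt _ _ (by simpa [Fin.lt_def] using h3)] at this
    simpa using congrArg Fin.val this
  · have := insMax_self n p e
    have hh : (⟨i, hi⟩ : Fin (n+1)) = p := Fin.ext h4
    rw [hh, this]; simp
  · have := insMax_succAbove n p e ⟨i - 1, by omega⟩
    rw [Fin.succAbove_of_le_castSucc _ _ (by simp [Fin.le_def]; omega)] at this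
    have hh : (Fin.succ ⟨i - 1, by omega⟩ : Fin (n+1)) = ⟨i, hi⟩ := Fin.ext (by simp; omega)
    rw [hh] at this
    simpa using congrArg Fin.val this

theorem sum_insMax (m : ℕ) (g : ℕ → ℕ) (e : Equiv.Perm (Fin (m+1))) :
    ∑ p : Fin (m+2), g (permRises (insMax (m+1) (p, e))) =
      (permRises e + 1) * g (permRises e) + (m + 1 - permRises e) * g (permRises e + 1) := by
  unfold permRises
  simp only [ofFn_insMax]
  rw [Fin.sum_univ_eq_sum_range
    (fun p => g (listRises ((List.ofFn fun i => (e i : ℕ)).insertIdx p (m+1))))]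
  have hlt : ∀ x ∈ (List.ofFn fun i => (e i : ℕ)), x < m + 1 := by
    intro x hx
    rw [List.mem_ofFn] at hx
    obtain ⟨i, rfl⟩ := hx
    exact (e i).isLt
  have hlen : (List.ofFn fun i => (e i : ℕ)).length = m + 1 := by simp
  generalize (List.ofFn fun i => (e i : ℕ)) = l at hlt hlen
  cases l with
  | nil => simp at hlen
  | cons a t =>
    have := listRises_insert (m+1) g a t hlt
    rw [hlen] at this
    exact this

theorem eulerian_succ (m k : ℕ) :
    eulerian (m+1) k = ∑ e : Equiv.Perm (Fin (m+1)),
      ((permRises e + 1) * (if permRises e = k then 1 else 0) +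
        (m + 1 - permRises e) * (if permRises e + 1 = k then 1 else 0)) := by
  unfold eulerian
  rw [Finset.card_filter, ← (insMax_bijective (m+1)).sum_comp, Fintype.sum_prod_type_right]
  exact Finset.sum_congr rfl fun e _ => sum_insMax m (fun r => if r = k then 1 else 0) e

theorem eulerian_recursion (n : ℕ) (hn : 1 ≤ n) :
    (∀ k : ℕ, 1 ≤ k → k ≤ n →
      eulerian n k = (n - k + 1) * eulerian (n - 1) (k - 1) + (k + 1) * eulerian (n - 1) k) ∧
    eulerian n 0 = eulerian (n - 1) 0 ∧
    eulerian 0 0 = 1 := by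
  obtain ⟨m, rfl⟩ : ∃ m, n = m + 1 := ⟨n - 1, by omega⟩
  refine ⟨?_, ?_, ?_⟩
  · intro k hk hkn
    rw [eulerian_succ]
    simp only [Nat.add_sub_cancel, eulerian, Finset.card_filter, Finset.mul_sum]
    rw [← Finset.sum_add_distrib]
    refine Finset.sum_congr rfl fun e _ => ?_
    generalize permRises e = r
    by_cases h1 : r = k
    · subst h1
      have : ¬ r = r - 1 := by omega
      simp [this]
    · by_cases h2 : r + 1 = k
      · subst h2
        simp
        omega
      · have : ¬ r = k - 1 := by omega
        simp [h1, h2, this]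
  · rw [eulerian_succ]
    simp only [Nat.add_sub_cancel, eulerian, Finset.card_filter]
    refine Finset.sum_congr rfl fun e _ => ?_
    by_cases h : permRises e = 0 <;> simp [h]
  · decide
end

section
/- Let σ be a permutation of Fin (n+1) with exactly k rises. There are exactly n+2 permutations τ of Fin (n+2) whose pattern on the values {0,…,n} equals σ (they are obtained by inserting the value n+1 into each of the n+2 slots of the sequence σ(0),…,σ(n)). Every such τ has exactly k or k+1 rises; exactly k+1 of them have exactly k rises, and exactly n−k+1 of them have exactly k+1 rises. -/
/-- The subsequence of `σ 0, …, σ (m-1)` consisting of the entries `< j`. -/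
def patternList {m : ℕ} (σ : Equiv.Perm (Fin m)) (j : ℕ) : List ℕ :=
  (List.ofFn fun i => (σ i : ℕ)).filter (· < j)

/-- `IsPattern σ π` says that the pattern of `σ` on the values `{0, …, m₀-1}`
is the permutation `π` of `Fin m₀`. -/
def IsPattern {m m₀ : ℕ} (σ : Equiv.Perm (Fin m)) (π : Equiv.Perm (Fin m₀)) : Prop :=
  patternList σ m₀ = List.ofFn fun j => (π j : ℕ)

instance {m m₀ : ℕ} (σ : Equiv.Perm (Fin m)) (π : Equiv.Perm (Fin m₀)) :
    Decidable (IsPattern σ π) := by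
  unfold IsPattern; infer_instance

theorem listRises_single (a : ℕ) : listRises [a] = 0 := by simp [listRises]

theorem listRises_lt (l : List ℕ) (hl : l ≠ []) : listRises l < l.length := by
  induction l with
  | nil => exact absurd rfl hl
  | cons a t ih =>
    cases t with
    | nil => simp [listRises_single]
    | cons b t =>
      have := ih (by simp)
      rw [listRises_cons_cons]
      simp only [List.length_cons] at *
      split_ifs <;> omega

theorem rises_insert_zero (M a : ℕ) (l : List ℕ) (h : a < M) :
    listRises ((a :: l).insertIdx 0 M) = listRises (a :: l) := by
  simp [listRises_cons_cons, Nat.not_lt.2 h.le]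

theorem rises_insert_cases (M : ℕ) (l : List ℕ) : ∀ (a : ℕ), (∀ x ∈ a :: l, x < M) →
    ∀ p ≤ l.length,
    listRises ((a :: l).insertIdx (p + 1) M) = listRises (a :: l) ∨
    listRises ((a :: l).insertIdx (p + 1) M) = listRises (a :: l) + 1 := by
  induction l with
  | nil =>
    intro a h p hp
    have hp : p = 0 := by simpa using hp
    subst hp
    have : a < M := h a (by simp)
    simp [listRises_cons_cons, listRises_single, this]
  | cons b l ih =>
    intro a h p hp
    have ha : a < M := h a (by simp)
    have hb : b < M := h b (by simp)
    cases p with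
    | zero =>
      simp only [List.insertIdx_succ_cons, List.insertIdx_zero, listRises_cons_cons, ha,
        Nat.not_lt.2 hb.le, if_true, if_false]
      split_ifs <;> omega
    | succ p =>
      have := ih b (fun x hx => h x (List.mem_cons_of_mem _ hx)) p (by simpa using hp)
      simp only [List.insertIdx_succ_cons, listRises_cons_cons] at this ⊢
      omega

theorem rises_insert_count (M : ℕ) (l : List ℕ) : ∀ (a : ℕ), (∀ x ∈ a :: l, x < M) →
    ∑ p ∈ Finset.range (l.length + 1),
      (if listRises ((a :: l).insertIdx (p + 1) M) = listRises (a :: l) then 1 else 0)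
      = listRises (a :: l) := by
  induction l with
  | nil =>
    intro a h
    have : a < M := h a (by simp)
    simp [listRises_cons_cons, listRises_single, this]
  | cons b l ih =>
    intro a h
    have ha : a < M := h a (by simp)
    have hb : b < M := h b (by simp)
    have := ih b (fun x hx => h x (List.mem_cons_of_mem _ hx))
    rw [List.length_cons, Finset.sum_range_succ']
    simp only [List.insertIdx_succ_cons, List.insertIdx_zero, listRises_cons_cons,
      Nat.add_left_cancel_iff, ha, Nat.not_lt.2 hb.le, if_true, if_false] at this ⊢
    refine (congrArg (· + _) (Eq.trans ?_ this)).trans ?_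
    · exact Finset.sum_congr rfl (fun _ _ => by congr)
    · beta_reduce
      split_ifs <;> omega

theorem ofFn_eq_insertIdx : ∀ (m : ℕ) (f : Fin (m + 1) → ℕ) (p : Fin (m + 1)),
    List.ofFn f = (List.ofFn fun j => f (p.succAbove j)).insertIdx p (f p) := by
  intro m
  induction m with
  | zero =>
    intro f p
    have : p = 0 := Fin.ext (by have := p.isLt; simp only [Fin.val_zero]; omega)
    subst this
    simp
  | succ m ih =>
    intro f p
    refine Fin.cases ?_ (fun q => ?_) p
    · simp [List.ofFn_succ]
    · rw [List.ofFn_succ, ih (fun i => f i.succ) q]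
      conv_rhs => rw [List.ofFn_succ]
      simp

/-- Insert the largest value at slot `p`. -/
def insPerm {n : ℕ} (σ : Equiv.Perm (Fin (n + 1))) (p : Fin (n + 2)) :
    Equiv.Perm (Fin (n + 2)) :=
  (finSuccEquiv' p).trans ((Equiv.optionCongr σ).trans (finSuccEquiv' (Fin.last (n + 1))).symm)

theorem insPerm_self {n : ℕ} (σ : Equiv.Perm (Fin (n + 1))) (p : Fin (n + 2)) :
    insPerm σ p p = Fin.last (n + 1) := by
  simp [insPerm]

theorem insPerm_succAbove {n : ℕ} (σ : Equiv.Perm (Fin (n + 1))) (p : Fin (n + 2))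
    (j : Fin (n + 1)) : insPerm σ p (p.succAbove j) = (σ j).castSucc := by
  simp [insPerm]

theorem insPerm_injective {n : ℕ} (σ : Equiv.Perm (Fin (n + 1))) :
    Function.Injective (insPerm σ) := by
  intro p q h
  have h1 := insPerm_self σ p
  rw [h, ← insPerm_self σ q] at h1
  exact (insPerm σ q).injective h1

theorem insPerm_list {n : ℕ} (σ : Equiv.Perm (Fin (n + 1))) (p : Fin (n + 2)) :
    (List.ofFn fun i => (insPerm σ p i : ℕ)) =
      (List.ofFn fun j => (σ j : ℕ)).insertIdx p (n + 1) := by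
  rw [ofFn_eq_insertIdx _ _ p]
  simp [insPerm_self, insPerm_succAbove]

theorem filter_insertIdx (M : ℕ) (l : List ℕ) : ∀ p : ℕ, (∀ x ∈ l, x < M) →
    (l.insertIdx p M).filter (· < M) = l := by
  induction l with
  | nil => intro p _; cases p <;> simp
  | cons a l ih =>
    intro p h
    cases p with
    | zero => simpa using h
    | succ p =>
      have := ih p (fun x hx => h x (List.mem_cons_of_mem _ hx))
      rw [List.insertIdx_succ_cons, List.filter_cons_of_pos (by simpa using h a (by simp)), this]

theorem isPattern_iff {n : ℕ} (σ : Equiv.Perm (Fin (n + 1))) (τ : Equiv.Perm (Fin (n + 2))) :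
    IsPattern τ σ ↔ ∃ p, insPerm σ p = τ := by
  constructor
  · intro h
    refine ⟨τ.symm (Fin.last _), ?_⟩
    set p := τ.symm (Fin.last (n + 1)) with hp
    have hτp : τ p = Fin.last (n + 1) := by simp [hp]
    unfold IsPattern patternList at h
    rw [ofFn_eq_insertIdx _ _ p, hτp, Fin.val_last, filter_insertIdx] at h
    · have h2 := List.ofFn_injective h
      ext i
      rcases Fin.eq_self_or_eq_succAbove p i with rfl | ⟨j, rfl⟩
      · rw [insPerm_self, hτp]
      · rw [insPerm_succAbove]
        exact (congrFun h2 j).symm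
    · intro x hx
      rw [List.mem_ofFn] at hx
      obtain ⟨j, rfl⟩ := hx
      have h3 : τ (p.succAbove j) ≠ Fin.last (n + 1) := by
        rw [← hτp]
        exact fun h => Fin.succAbove_ne p j (τ.injective h)
      exact Fin.val_lt_last h3
  · rintro ⟨p, rfl⟩
    unfold IsPattern patternList
    rw [insPerm_list, filter_insertIdx]
    intro x hx
    rw [List.mem_ofFn] at hx
    obtain ⟨j, rfl⟩ := hx
    exact (σ j).isLt

theorem card_ins {n : ℕ} (σ : Equiv.Perm (Fin (n + 1))) (P : Equiv.Perm (Fin (n + 2)) → Prop)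
    [DecidablePred P] :
    (Finset.univ.filter fun τ : Equiv.Perm (Fin (n + 2)) => IsPattern τ σ ∧ P τ).card =
    (Finset.univ.filter fun p : Fin (n + 2) => P (insPerm σ p)).card := by
  symm
  rw [← Finset.card_image_of_injective _ (insPerm_injective σ)]
  congr 1
  ext τ
  simp only [Finset.mem_image, Finset.mem_filter, Finset.mem_univ, true_and, isPattern_iff]
  constructor
  · rintro ⟨p, h, rfl⟩
    exact ⟨⟨p, rfl⟩, h⟩
  · rintro ⟨⟨p, rfl⟩, h⟩
    exact ⟨p, h, rfl⟩

theorem insPerm_cases {n : ℕ} (σ : Equiv.Perm (Fin (n + 1))) (p : Fin (n + 2)) :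
    permRises (insPerm σ p) = permRises σ ∨ permRises (insPerm σ p) = permRises σ + 1 := by
  unfold permRises
  rw [insPerm_list]
  have hlt : ∀ x ∈ (List.ofFn fun j => (σ j : ℕ)), x < n + 1 := by
    intro x hx
    rw [List.mem_ofFn] at hx
    obtain ⟨j, rfl⟩ := hx
    exact (σ j).isLt
  rw [List.ofFn_succ] at hlt ⊢
  refine Fin.cases ?_ (fun q => ?_) p
  · left
    exact rises_insert_zero _ _ _ (hlt _ (by simp))
  · exact rises_insert_cases _ _ _ hlt q (by simpa using Nat.lt_succ_iff.1 q.isLt)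

theorem insPerm_count {n : ℕ} (σ : Equiv.Perm (Fin (n + 1))) :
    (Finset.univ.filter fun p : Fin (n + 2) => permRises (insPerm σ p) = permRises σ).card =
      permRises σ + 1 := by
  unfold permRises
  simp only [insPerm_list]
  have hlt : ∀ x ∈ (List.ofFn fun j => (σ j : ℕ)), x < n + 1 := by
    intro x hx
    rw [List.mem_ofFn] at hx
    obtain ⟨j, rfl⟩ := hx
    exact (σ j).isLt
  rw [List.ofFn_succ] at hlt ⊢
  have h1 := rises_insert_count _ _ _ hlt
  rw [List.length_ofFn] at h1
  rw [Finset.card_filter, Fin.sum_univ_succ, Fin.val_zero,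
    if_pos (rises_insert_zero _ _ _ (hlt _ (by simp)))]
  rw [Finset.sum_range] at h1
  simp only [Fin.val_succ]
  rw [h1, Nat.add_comm]

theorem permRises_le {n : ℕ} (σ : Equiv.Perm (Fin (n + 1))) : permRises σ ≤ n := by
  have := listRises_lt (List.ofFn fun i => (σ i : ℕ)) (by simp)
  rw [List.length_ofFn] at this
  exact Nat.lt_succ_iff.1 this

/-- Let `σ` be a permutation of `Fin (n+1)` with exactly `k` rises.  There are exactly
`n+2` permutations `τ` of `Fin (n+2)` whose pattern on the values `{0,…,n}` equals `σ`;
every such `τ` has exactly `k` or `k+1` rises; exactly `k+1` of them have exactly `k`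
rises, and exactly `n-k+1` of them have exactly `k+1` rises. -/
theorem insertions_count (n k : ℕ) (σ : Equiv.Perm (Fin (n + 1))) (hσ : permRises σ = k) :
    (Finset.univ.filter fun τ : Equiv.Perm (Fin (n + 2)) => IsPattern τ σ).card = n + 2 ∧
    (∀ τ : Equiv.Perm (Fin (n + 2)), IsPattern τ σ →
      permRises τ = k ∨ permRises τ = k + 1) ∧
    (Finset.univ.filter fun τ : Equiv.Perm (Fin (n + 2)) =>
      IsPattern τ σ ∧ permRises τ = k).card = k + 1 ∧
    (Finset.univ.filter fun τ : Equiv.Perm (Fin (n + 2)) =>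
      IsPattern τ σ ∧ permRises τ = k + 1).card = n - k + 1 := by
  subst hσ
  refine ⟨?_, ?_, ?_, ?_⟩
  · have := card_ins σ (fun _ => True)
    simpa using this
  · intro τ h
    obtain ⟨p, rfl⟩ := (isPattern_iff σ τ).1 h
    exact insPerm_cases σ p
  · rw [card_ins σ (fun τ => permRises τ = permRises σ), insPerm_count]
  · rw [card_ins σ (fun τ => permRises τ = permRises σ + 1)]
    have h1 := insPerm_count σ
    have h2 := Finset.card_filter_add_card_filter_not (s := (Finset.univ : Finset (Fin (n + 2))))
      (fun p => permRises (insPerm σ p) = permRises σ)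
    have h3 : (Finset.univ.filter fun p : Fin (n + 2) =>
        ¬ permRises (insPerm σ p) = permRises σ) =
        Finset.univ.filter fun p : Fin (n + 2) => permRises (insPerm σ p) = permRises σ + 1 := by
      apply Finset.filter_congr
      intro p _
      have := insPerm_cases σ p
      omega
    rw [h3, h1, Finset.card_univ, Fintype.card_fin] at h2
    have := permRises_le σ
    omega
end

section
/- Fix n₀ < n and k ∈ ℕ. For a permutation π of Fin (n₀+1), let N(π) denote the number of permutations σ of Fin (n+1) with exactly k rises such that the pattern of σ on the values {0,…,n₀} equals π and no two positions of the sequence σ(0),…,σ(n) carrying values ≤ n₀ are adjacent. Then N(π) = N(π′) for any two permutations π, π′ of Fin (n₀+1); that is, this count does not depend on the order pattern π. -/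
/-- `NoAdjLow σ n₀`: no two positions of the sequence `σ 0, …, σ n` carrying
values `≤ n₀` are adjacent. -/
def NoAdjLow {n : ℕ} (σ : Equiv.Perm (Fin (n + 1))) (n₀ : ℕ) : Prop :=
  ∀ i : Fin n, ¬((σ i.castSucc : ℕ) ≤ n₀ ∧ (σ i.succ : ℕ) ≤ n₀)

instance {n : ℕ} (σ : Equiv.Perm (Fin (n + 1))) (n₀ : ℕ) : Decidable (NoAdjLow σ n₀) := by
  unfold NoAdjLow; infer_instance


theorem aux_rises (m : ℕ) (g : ℕ → ℕ) (h1 : ∀ v, v < m → g v < m) (h2 : ∀ v, m ≤ v → g v = v)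
    (l : List ℕ) (hl : l.IsChain (fun a b => ¬(a < m ∧ b < m))) :
    listRises (l.map g) = listRises l := by
  induction l with
  | nil => rfl
  | cons a t ih =>
    cases t with
    | nil => rfl
    | cons b t =>
      rw [List.isChain_cons_cons] at hl
      have ih' := ih hl.2
      have key : (g a < g b) ↔ (a < b) := by
        have a1 := h1 a
        have a2 := h2 a
        have b1 := h1 b
        have b2 := h2 b
        have := hl.1
        by_cases ha : a < m <;> by_cases hb : b < m <;> grind
      simp only [listRises, List.map_cons, List.tail_cons, List.zip_cons_cons, List.filter_cons,
        key] at ih' ⊢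
      split <;> simp_all

theorem aux_le (n₀ n k : ℕ) (hn : n₀ < n) (π π' : Equiv.Perm (Fin (n₀ + 1))) :
    (Finset.univ.filter fun σ : Equiv.Perm (Fin (n + 1)) =>
      permRises σ = k ∧ IsPattern σ π ∧ NoAdjLow σ n₀).card ≤
    (Finset.univ.filter fun σ : Equiv.Perm (Fin (n + 1)) =>
      permRises σ = k ∧ IsPattern σ π' ∧ NoAdjLow σ n₀).card := by
  let ρ : Equiv.Perm (Fin (n₀ + 1)) := π' * π⁻¹
  let f : Fin (n₀ + 1) ↪ Fin (n + 1) := Fin.castLEEmb (by omega)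
  let τ : Equiv.Perm (Fin (n + 1)) := ρ.viaFintypeEmbedding f
  let g : ℕ → ℕ := fun v => if h : v < n₀ + 1 then (ρ ⟨v, h⟩ : ℕ) else v
  have g2 : ∀ v, n₀ + 1 ≤ v → g v = v := by
    intro v hv
    simp only [g, not_lt.mpr hv, dite_false]
  have hτ : ∀ x, (τ x : ℕ) = g x := by
    intro x
    by_cases hx : (x : ℕ) < n₀ + 1
    · have : x = f ⟨x, hx⟩ := by ext; simp [f]
      have h2 : τ (f ⟨x, hx⟩) = f (ρ ⟨x, hx⟩) := Equiv.Perm.viaFintypeEmbedding_apply_image ..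
      rw [← this] at h2
      rw [h2]
      simp only [g, hx, dite_true]
      simp [f]
    · have h2 : τ x = x := by
        apply Equiv.Perm.viaFintypeEmbedding_apply_notMem_range
        rintro ⟨y, hy⟩
        apply hx
        rw [← hy]
        exact y.isLt
      rw [h2, g2 x (by omega)]
  have g1 : ∀ v, v < n₀ + 1 → g v < n₀ + 1 := by
    intro v hv
    simp only [g, hv, dite_true]
    exact (ρ ⟨v, hv⟩).isLt
  have g3 : ∀ v, g v < n₀ + 1 ↔ v < n₀ + 1 := by
    intro v
    refine ⟨fun h => ?_, g1 v⟩
    by_contra hv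
    have := g2 v (by omega)
    omega
  have hlist : ∀ σ : Equiv.Perm (Fin (n + 1)),
      (List.ofFn fun i => ((τ * σ) i : ℕ)) = (List.ofFn fun i => (σ i : ℕ)).map g := by
    intro σ
    rw [List.map_ofFn]
    congr 1
    funext i
    simp [hτ]
  apply Finset.card_le_card_of_injOn (fun σ => τ * σ)
  · intro σ hσ
    simp only [Finset.coe_filter, Finset.mem_univ, true_and, Set.mem_ofPred_eq] at hσ ⊢
    obtain ⟨hk, hp, ha⟩ := hσ
    refine ⟨?_, ?_, ?_⟩
    · rw [← hk, permRises, permRises, hlist]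
      apply aux_rises (n₀ + 1) g g1 g2
      rw [List.isChain_iff_getElem]
      intro i hi
      have hi' : i < n := by simpa using hi
      have := ha ⟨i, hi'⟩
      rw [List.getElem_ofFn, List.getElem_ofFn]
      simp only [Nat.lt_succ_iff]
      exact this
    · unfold IsPattern patternList at hp ⊢
      rw [hlist, List.filter_map]
      have : ((fun x => decide (x < n₀ + 1)) ∘ g) = fun x => decide (x < n₀ + 1) := by
        funext v
        simp only [Function.comp, g3]
      rw [this, hp, List.map_ofFn]
      congr 1
      funext i
      have hi : (π i : ℕ) < n₀ + 1 := (π i).isLt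
      simp only [Function.comp, g, hi, dite_true]
      simp [ρ]
    · intro i
      have := ha i
      have e1 := g3 (σ i.castSucc)
      have e2 := g3 (σ i.succ)
      simp only [Equiv.Perm.mul_apply, hτ]
      omega
  · intro a _ b _ h
    exact mul_left_cancel h

/-- The number of permutations `σ` of `Fin (n+1)` with exactly `k` rises whose pattern
on `{0,…,n₀}` equals `π` and in which no two positions carrying values `≤ n₀` are
adjacent does not depend on the order pattern `π`. -/
theorem singleton_clusters_count_independent (n₀ n k : ℕ) (hn : n₀ < n)
    (π π' : Equiv.Perm (Fin (n₀ + 1))) :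
    (Finset.univ.filter fun σ : Equiv.Perm (Fin (n + 1)) =>
      permRises σ = k ∧ IsPattern σ π ∧ NoAdjLow σ n₀).card =
    (Finset.univ.filter fun σ : Equiv.Perm (Fin (n + 1)) =>
      permRises σ = k ∧ IsPattern σ π' ∧ NoAdjLow σ n₀).card := by
  exact le_antisymm (aux_le n₀ n k hn π π') (aux_le n₀ n k hn π' π)
end

section
/- Fix n₀ < n, k, r ∈ ℕ, a permutation π of Fin (n₀+1), and a permutation ρ of Fin (n−n₀) with exactly r rises. The number of permutations σ of Fin (n+1) with exactly k rises such that (a) the pattern of σ on the values {0,…,n₀} equals π, (b) the subsequence of σ(0),…,σ(n) consisting of entries ≥ n₀+1, with each entry x replaced by x−(n₀+1), equals the sequence ρ(0),…,ρ(n−n₀−1), and (c) no two positions carrying values ≤ n₀ are adjacent, equals C(n−n₀−r, k−r) · C(r+1, (n₀+1)−(k−r)), where C denotes the binomial coefficient with the convention C(a,b)=0 when b < 0 or b > a. In particular this number depends neither on π nor on ρ except through r. -/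
/-- Binomial coefficient on integers, with the convention `C(a,b) = 0`
when `b < 0` or `b > a`. -/
def chooseZ (a b : ℤ) : ℤ :=
  if 0 ≤ b ∧ b ≤ a then (a.toNat.choose b.toNat : ℤ) else 0

/-- All interleavings of `A` and `B` in which at most one entry of `A` goes in each gap of `B`. -/
def gapWords : List ℕ → List ℕ → List (List ℕ)
  | [], [] => [[]]
  | [a], [] => [[a]]
  | _ :: _ :: _, [] => []
  | [], b :: B => (gapWords [] B).map (fun t => b :: t)
  | a :: A, b :: B => (gapWords (a :: A) B).map (fun t => b :: t) ++
      (gapWords A B).map (fun t => a :: b :: t)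

theorem listRises_cons_top (N : ℕ) (l : List ℕ) (h : ∀ x ∈ l, x ≤ N) :
    listRises (N :: l) = listRises l := by
  cases l with
  | nil => simp [listRises]
  | cons b l =>
    have : ¬ N < b := by have := h b (by simp); omega
    rw [listRises_cons_cons, if_neg this, zero_add]

theorem listRises_map_add (m : ℕ) (l : List ℕ) :
    listRises (l.map (· + m)) = listRises l := by
  induction l with
  | nil => rfl
  | cons a l ih =>
    cases l with
    | nil => simp [listRises]
    | cons b l =>
      simp only [List.map_cons] at ih ⊢
      rw [listRises_cons_cons, listRises_cons_cons, ih]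
      simp

theorem listRises_cons_le (b : ℕ) (l : List ℕ) : listRises (b :: l) ≤ l.length := by
  induction l generalizing b with
  | nil => simp [listRises]
  | cons c l ih =>
    rw [listRises_cons_cons]
    have := ih c
    simp only [List.length_cons]
    split_ifs <;> omega

theorem chooseZ_nat (a b : ℕ) : chooseZ a b = a.choose b := by
  unfold chooseZ
  split_ifs with h
  · simp
  · rw [Nat.choose_eq_zero_of_lt (by omega)]; simp

theorem chooseZ_neg (a b : ℤ) (h : b < 0) : chooseZ a b = 0 := by
  unfold chooseZ
  rw [if_neg (by omega)]

theorem chooseZ_pascal (a b : ℤ) (ha : 0 ≤ a) :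
    chooseZ (a + 1) b = chooseZ a b + chooseZ a (b - 1) := by
  lift a to ℕ using ha
  rcases lt_or_ge b 0 with hb | hb
  · rw [chooseZ_neg _ _ hb, chooseZ_neg _ _ hb, chooseZ_neg _ _ (by omega)]; simp
  · lift b to ℕ using hb
    cases b with
    | zero =>
      rw [chooseZ_neg _ ((0 : ℕ) - 1) (by simp)]
      have h1 := chooseZ_nat (a + 1) 0
      have h2 := chooseZ_nat a 0
      push_cast at h1 h2 ⊢
      rw [h1, h2]; simp
    | succ b =>
      have h1 := chooseZ_nat (a + 1) (b + 1)
      have h2 := chooseZ_nat a (b + 1)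
      have h3 := chooseZ_nat a b
      rw [Nat.choose_succ_succ] at h1
      push_cast at h1 h2 ⊢
      rw [h1, h2, add_sub_cancel_right, h3]; ring

theorem chooseZ_zero_left (b : ℤ) : chooseZ 0 b = if b = 0 then 1 else 0 := by
  unfold chooseZ
  by_cases h : b = 0
  · subst h; simp
  · rw [if_neg (by omega), if_neg h]

theorem countP_congr_fun (L : List (List ℕ)) (p q : List ℕ → Bool)
    (h : ∀ t ∈ L, p t = q t) : L.countP p = L.countP q :=
  List.countP_congr (fun t ht => by rw [h t ht])

/-- The number of words with prescribed rises, after a leading high entry `b`. -/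
theorem gapWords_count (m : ℕ) (B : List ℕ) : ∀ (A : List ℕ) (b : ℕ) (k : ℤ),
    (∀ x ∈ A, x < m) → m ≤ b → (∀ x ∈ B, m ≤ x) →
    (((gapWords A B).countP (fun t => decide ((listRises (b :: t) : ℤ) = k)) : ℕ) : ℤ) =
      chooseZ ((B.length : ℤ) - listRises (b :: B)) (k - listRises (b :: B)) *
        chooseZ ((listRises (b :: B) : ℤ) + 1) ((A.length : ℤ) - (k - listRises (b :: B))) := by
  induction B with
  | nil =>
    intro A b k hA hb hB
    rw [listRises_single]
    simp only [List.length_nil, Nat.cast_zero, sub_zero, zero_add]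
    rw [chooseZ_zero_left]
    rcases A with _ | ⟨a, _ | ⟨a', A⟩⟩
    · by_cases hk : k = 0
      · subst hk; simp [gapWords, listRises, chooseZ]
      · simp [gapWords, listRises, hk, Ne.symm hk]
    · have hab : ¬ b < a := by have := hA a (by simp); omega
      have hr : listRises [b, a] = 0 := by rw [listRises_cons_cons, if_neg hab, listRises_single]
      by_cases hk : k = 0
      · subst hk; simp [gapWords, hr, chooseZ]
      · simp [gapWords, hr, hk, Ne.symm hk]
    · by_cases hk : k = 0
      · subst hk
        simp only [gapWords, List.countP_nil, List.length_cons]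
        unfold chooseZ
        rw [if_neg (by omega : ¬ (0 ≤ (((A.length + 1 + 1 : ℕ) : ℤ) - 0) ∧ (((A.length + 1 + 1 : ℕ) : ℤ) - 0) ≤ 1))]
        simp
      · simp [gapWords, hk]
  | cons c B ih =>
    intro A b k hA hb hB
    have hc : m ≤ c := hB c (by simp)
    have hB' : ∀ x ∈ B, m ≤ x := fun x hx => hB x (by simp [hx])
    have hle := listRises_cons_le c B
    set r := listRises (c :: B) with hr
    -- the words starting with `c`
    have key1 : ((((gapWords A B).map (fun t => c :: t)).countP
        (fun t => decide ((listRises (b :: t) : ℤ) = k)) : ℕ) : ℤ) =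
        chooseZ ((B.length : ℤ) - r) (k - (if b < c then 1 else 0) - r) *
        chooseZ ((r : ℤ) + 1) ((A.length : ℤ) - (k - (if b < c then 1 else 0) - r)) := by
      rw [← ih A c _ hA hc hB', List.countP_map]
      congr 1
      apply countP_congr_fun
      intro t _
      simp only [Function.comp, listRises_cons_cons, decide_eq_decide]
      split_ifs <;> push_cast <;> constructor <;> intro h <;> linarith
    have key2 : ∀ a A', A = a :: A' → ((((gapWords A' B).map (fun t => a :: c :: t)).countP
        (fun t => decide ((listRises (b :: t) : ℤ) = k)) : ℕ) : ℤ) =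
        chooseZ ((B.length : ℤ) - r) (k - 1 - r) *
        chooseZ ((r : ℤ) + 1) ((A.length : ℤ) - 1 - (k - 1 - r)) := by
      intro a A' hAe
      subst hAe
      have ha : a < m := hA a (by simp)
      have hl : (((a :: A').length : ℤ) - 1) = A'.length := by simp
      rw [hl, ← ih A' c _ (fun x hx => hA x (by simp [hx])) hc hB', List.countP_map]
      congr 1
      apply countP_congr_fun
      intro t _
      have h1 : ¬ b < a := by omega
      have h2 : a < c := by omega
      simp only [Function.comp, listRises_cons_cons, decide_eq_decide, if_neg h1, if_pos h2]
      push_cast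
      constructor <;> intro h <;> linarith
    have key : (((gapWords A (c :: B)).countP
        (fun t => decide ((listRises (b :: t) : ℤ) = k)) : ℕ) : ℤ) =
        chooseZ ((B.length : ℤ) - r) (k - (if b < c then 1 else 0) - r) *
        chooseZ ((r : ℤ) + 1) ((A.length : ℤ) - (k - (if b < c then 1 else 0) - r)) +
        chooseZ ((B.length : ℤ) - r) (k - 1 - r) *
        chooseZ ((r : ℤ) + 1) ((A.length : ℤ) - 1 - (k - 1 - r)) := by
      cases A with
      | nil =>
        rw [gapWords, key1]
        have : chooseZ ((B.length : ℤ) - r) (k - 1 - r) *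
          chooseZ ((r : ℤ) + 1) ((([] : List ℕ).length : ℤ) - 1 - (k - 1 - r)) = 0 := by
          rcases lt_or_ge (k - 1 - r) 0 with h | h
          · rw [chooseZ_neg _ _ h, zero_mul]
          · rw [chooseZ_neg _ ((([] : List ℕ).length : ℤ) - 1 - (k - 1 - r)) (by rw [List.length_nil]; push_cast; linarith), mul_zero]
        rw [this, add_zero]
      | cons a A' =>
        rw [gapWords, List.countP_append]
        push_cast
        have h2 := key2 a A' rfl
        rw [key1, h2]
    rw [key, listRises_cons_cons, ← hr]
    by_cases hbc : b < c
    · simp only [if_pos hbc, List.length_cons]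
      push_cast
      have e1 : ((B.length : ℤ) + 1 - (1 + r)) = B.length - r := by ring
      have e2 : k - (1 + (r : ℤ)) = k - 1 - r := by ring
      have e3 : (1 + (r : ℤ) + 1) = (r + 1) + 1 := by ring
      rw [e1, e2, e3, chooseZ_pascal ((r : ℤ) + 1) _ (by omega)]
      have e4 : (A.length : ℤ) - (k - 1 - r) - 1 = A.length - 1 - (k - 1 - r) := by ring
      rw [e4]; ring
    · simp only [if_neg hbc, List.length_cons]
      push_cast
      have e1 : ((B.length : ℤ) + 1 - (0 + r)) = (B.length - r) + 1 := by ring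
      rw [e1, chooseZ_pascal ((B.length : ℤ) - r) _ (by omega)]
      have e4 : (A.length : ℤ) - 1 - (k - 1 - r) = A.length - (k - r) := by ring
      have e5 : k - (r : ℤ) - 1 = k - 1 - r := by ring
      rw [e4, zero_add, sub_zero, e5]; ring

/-- No two adjacent entries are `< m`. -/
def noAdj (m : ℕ) (l : List ℕ) : Prop := l.IsChain (fun x y => ¬ (x < m ∧ y < m))

theorem mem_gapWords_of (m : ℕ) : ∀ l : List ℕ, noAdj m l →
    l ∈ gapWords (l.filter (· < m)) (l.filter (m ≤ ·))
  | [], _ => by simp [gapWords]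
  | [x], _ => by
    by_cases h : x < m
    · simp [h, gapWords]
    · have h' : m ≤ x := by omega
      simp [h, h', gapWords]
  | x :: y :: t, hc => by
    unfold noAdj at hc
    have ih1 := mem_gapWords_of m (y :: t) (List.isChain_cons_cons.1 hc).2
    have ih2 := mem_gapWords_of m t (List.isChain_cons.1 (List.isChain_cons_cons.1 hc).2).2
    by_cases h : x < m
    · have hy : ¬ y < m := fun hy => (List.isChain_cons_cons.1 hc).1 ⟨h, hy⟩
      have hy' : m ≤ y := by omega
      have hx' : ¬ m ≤ x := by omega
      simp only [List.filter_cons, h, hy, hy', hx', decide_true, decide_false, if_true]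
      simp only [Bool.false_eq_true, if_false, gapWords, List.mem_append, List.mem_map]
      exact Or.inr ⟨t, ih2, rfl⟩
    · have hx' : m ≤ x := by omega
      have f1 : (x :: y :: t).filter (· < m) = (y :: t).filter (· < m) :=
        List.filter_cons_of_neg (by simpa using h)
      have f2 : (x :: y :: t).filter (m ≤ ·) = x :: (y :: t).filter (m ≤ ·) :=
        List.filter_cons_of_pos (by simpa using hx')
      rw [f1, f2]
      revert ih1
      generalize List.filter (fun x => decide (x < m)) (y :: t) = A
      generalize List.filter (fun x => decide (m ≤ x)) (y :: t) = B
      intro ih1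
      cases A <;> simp [gapWords, ih1]

theorem of_mem_gapWords (m : ℕ) (B : List ℕ) : ∀ (A l : List ℕ),
    (∀ x ∈ A, x < m) → (∀ x ∈ B, m ≤ x) → l ∈ gapWords A B →
    l.filter (· < m) = A ∧ l.filter (m ≤ ·) = B ∧ noAdj m l := by
  induction B with
  | nil =>
    intro A l hA hB hl
    rcases A with _ | ⟨a, _ | ⟨a', A⟩⟩
    · simp [gapWords] at hl; subst hl; simp [noAdj]
    · have ha : a < m := hA a (by simp)
      simp [gapWords] at hl; subst hl; simp [noAdj, ha]
    · simp [gapWords] at hl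
  | cons b B ih =>
    intro A l hA hB hl
    have hb : m ≤ b := hB b (by simp)
    have hb' : ¬ b < m := by omega
    have hB' : ∀ x ∈ B, m ≤ x := fun x hx => hB x (by simp [hx])
    have step1 : ∀ t A, (∀ x ∈ A, x < m) → t ∈ gapWords A B → (b :: t).filter (· < m) = A ∧
        (b :: t).filter (m ≤ ·) = b :: B ∧ noAdj m (b :: t) := by
      intro t A hA ht
      obtain ⟨h1, h2, h3⟩ := ih A t hA hB' ht
      refine ⟨?_, ?_, ?_⟩
      · rw [List.filter_cons_of_neg (by simpa using hb), h1]
      · rw [List.filter_cons_of_pos (by simpa using hb), h2]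
      · exact List.isChain_cons.2 ⟨fun y _ h => hb' h.1, h3⟩
    cases A with
    | nil =>
      simp only [gapWords, List.mem_map] at hl
      obtain ⟨t, ht, rfl⟩ := hl
      exact step1 t [] hA ht
    | cons a A =>
      simp only [gapWords, List.mem_append, List.mem_map] at hl
      rcases hl with ⟨t, ht, rfl⟩ | ⟨t, ht, rfl⟩
      · exact step1 t _ hA ht
      · obtain ⟨h1, h2, h3⟩ := step1 t A (fun x hx => hA x (by simp [hx])) ht
        have ha : a < m := hA a (by simp)
        refine ⟨?_, ?_, ?_⟩
        · rw [List.filter_cons_of_pos (by simpa using ha), h1]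
        · rw [List.filter_cons_of_neg (by simpa using ha), h2]
        · exact List.isChain_cons_cons.2 ⟨fun h => hb' h.2, h3⟩

theorem gapWords_nodup (m : ℕ) (B : List ℕ) : ∀ (A : List ℕ),
    (∀ x ∈ A, x < m) → (∀ x ∈ B, m ≤ x) → (gapWords A B).Nodup := by
  induction B with
  | nil =>
    intro A hA hB
    rcases A with _ | ⟨a, _ | ⟨a', A⟩⟩ <;> simp [gapWords]
  | cons b B ih =>
    intro A hA hB
    have hb : m ≤ b := hB b (by simp)
    have hB' : ∀ x ∈ B, m ≤ x := fun x hx => hB x (by simp [hx])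
    cases A with
    | nil =>
      rw [gapWords]
      exact (ih _ hA hB').map (fun s t h => by simpa using h)
    | cons a A =>
      have ha : a < m := hA a (by simp)
      rw [gapWords]
      refine List.Nodup.append ((ih _ hA hB').map (fun s t h => by simpa using h))
        ((ih _ (fun x hx => hA x (by simp [hx])) hB').map (fun s t h => by simpa using h)) ?_
      intro l h1 h2
      simp only [List.mem_map] at h1 h2
      obtain ⟨s, _, rfl⟩ := h1
      obtain ⟨t, _, h⟩ := h2
      simp only [List.cons.injEq] at h
      omega

theorem exists_perm_of_list (N : ℕ) (l : List ℕ) (hl : l.length = N) (hnd : l.Nodup)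
    (hlt : ∀ x ∈ l, x < N) :
    ∃ σ : Equiv.Perm (Fin N), (List.ofFn fun i => (σ i : ℕ)) = l := by
  subst hl
  have hinj : Function.Injective
      (fun i : Fin l.length => (⟨l.get i, hlt _ (l.get_mem i)⟩ : Fin l.length)) := by
    intro i j h
    simp only [Fin.mk.injEq] at h
    exact List.nodup_iff_injective_get.1 hnd h
  refine ⟨Equiv.ofBijective _ (Finite.injective_iff_bijective.1 hinj), ?_⟩
  simp only [Equiv.ofBijective_apply]
  exact List.ofFn_get l

theorem noAdjLow_iff {n : ℕ} (σ : Equiv.Perm (Fin (n + 1))) (n₀ : ℕ) :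
    NoAdjLow σ n₀ ↔ noAdj (n₀ + 1) (List.ofFn fun i => (σ i : ℕ)) := by
  unfold NoAdjLow noAdj
  rw [List.isChain_iff_getElem]
  simp only [List.length_ofFn, List.getElem_ofFn, Nat.lt_succ_iff]
  constructor
  · intro h i hi
    exact h ⟨i, by omega⟩
  · intro h i
    exact h i (by omega)

/-- Given `π` a permutation of `Fin (n₀+1)` and `ρ` a permutation of `Fin (n-n₀)` with
exactly `r` rises, the number of permutations `σ` of `Fin (n+1)` with exactly `k` rises
such that (a) the pattern of `σ` on `{0,…,n₀}` is `π`, (b) the subsequence of entries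
`≥ n₀+1`, shifted down by `n₀+1`, is the sequence of `ρ`, and (c) no two positions
carrying values `≤ n₀` are adjacent, equals
`C(n-n₀-r, k-r) · C(r+1, (n₀+1)-(k-r))`. -/
theorem insertion_count_formula (n₀ n k r : ℕ) (hn : n₀ < n)
    (π : Equiv.Perm (Fin (n₀ + 1))) (ρ : Equiv.Perm (Fin (n - n₀)))
    (hρ : permRises ρ = r) :
    ((Finset.univ.filter fun σ : Equiv.Perm (Fin (n + 1)) =>
        permRises σ = k ∧ IsPattern σ π ∧
        ((List.ofFn fun i => (σ i : ℕ)).filter (fun x => n₀ + 1 ≤ x)).map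
            (fun x => x - (n₀ + 1)) = (List.ofFn fun j => (ρ j : ℕ)) ∧
        NoAdjLow σ n₀).card : ℤ) =
      chooseZ ((n : ℤ) - n₀ - r) ((k : ℤ) - r) *
        chooseZ ((r : ℤ) + 1) (((n₀ : ℤ) + 1) - ((k : ℤ) - r)) := by
  set A : List ℕ := List.ofFn fun j => (π j : ℕ) with hA
  set R : List ℕ := List.ofFn fun j => (ρ j : ℕ) with hR
  set B : List ℕ := R.map (· + (n₀ + 1)) with hB
  have hAlt : ∀ x ∈ A, x < (n₀ + 1) := by
    intro x hx
    simp only [hA, List.mem_ofFn] at hx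
    obtain ⟨j, rfl⟩ := hx
    exact (π j).2
  have hRlt : ∀ x ∈ R, x < n - n₀ := by
    intro x hx
    simp only [hR, List.mem_ofFn] at hx
    obtain ⟨j, rfl⟩ := hx
    exact (ρ j).2
  have hBge : ∀ x ∈ B, (n₀ + 1) ≤ x := by
    intro x hx
    simp only [hB, List.mem_map] at hx
    obtain ⟨j, _, rfl⟩ := hx
    omega
  have hBlt : ∀ x ∈ B, x < n + 1 := by
    intro x hx
    simp only [hB, List.mem_map] at hx
    obtain ⟨j, hj, rfl⟩ := hx
    have := hRlt j hj
    omega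
  have hAnd : A.Nodup := List.nodup_ofFn.2 (Fin.val_injective.comp π.injective)
  have hRnd : R.Nodup := List.nodup_ofFn.2 (Fin.val_injective.comp ρ.injective)
  have hBnd : B.Nodup := hRnd.map (fun x y h => by simpa using h)
  have hAlen : A.length = (n₀ + 1) := by simp [hA]
  have hBlen : B.length = n - n₀ := by simp [hB, hR]
  have hrB : listRises B = r := by rw [hB, listRises_map_add]; exact hρ
  -- shifting condition
  have hshift : ∀ l : List ℕ, ((l.filter (fun x => (n₀ + 1) ≤ x)).map (fun x => x - (n₀ + 1)) = R ↔
      l.filter (fun x => (n₀ + 1) ≤ x) = B) := by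
    intro l
    constructor
    · intro h
      rw [hB, ← h, List.map_map]
      symm
      conv_rhs => rw [← List.map_id (List.filter (fun x => decide ((n₀ + 1) ≤ x)) l)]
      apply List.map_congr_left
      intro x hx
      have : (n₀ + 1) ≤ x := by simpa using (List.mem_filter.1 hx).2
      simp only [Function.comp, id]
      omega
    · intro h
      rw [h, hB, List.map_map]
      conv_rhs => rw [← List.map_id R]
      apply List.map_congr_left
      intro x _
      simp
  have hcard : (Finset.univ.filter fun σ : Equiv.Perm (Fin (n + 1)) =>
        permRises σ = k ∧ IsPattern σ π ∧
        ((List.ofFn fun i => (σ i : ℕ)).filter (fun x => (n₀ + 1) ≤ x)).map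
            (fun x => x - (n₀ + 1)) = R ∧
        NoAdjLow σ n₀).card =
      (gapWords A B).countP (fun t => decide ((listRises ((n + 1) :: t) : ℤ) = (k : ℤ))) := by
    have hinj : Function.Injective
        (fun σ : Equiv.Perm (Fin (n + 1)) => List.ofFn fun i => (σ i : ℕ)) := by
      intro σ τ h
      ext i
      exact congrFun (List.ofFn_injective h) i
    rw [← Finset.card_image_of_injective _ hinj, List.countP_eq_length_filter,
      ← List.toFinset_card_of_nodup ((gapWords_nodup (n₀ + 1) B A hAlt hBge).filter _)]
    congr 1
    ext l
    simp only [Finset.mem_image, Finset.mem_filter, Finset.mem_univ, true_and, List.mem_toFinset,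
      List.mem_filter, decide_eq_true_eq, Nat.cast_inj]
    constructor
    · rintro ⟨σ, ⟨h1, h2, h3, h4⟩, rfl⟩
      rw [hshift] at h3
      rw [noAdjLow_iff] at h4
      have := mem_gapWords_of (n₀ + 1) _ h4
      unfold IsPattern patternList at h2
      rw [h2, h3] at this
      refine ⟨this, ?_⟩
      rw [listRises_cons_top]
      · exact h1
      · intro x hx
        simp only [List.mem_ofFn] at hx
        obtain ⟨j, rfl⟩ := hx
        exact (σ j).2.le
    · rintro ⟨hmem, hk⟩
      obtain ⟨h1, h2, h3⟩ := of_mem_gapWords (n₀ + 1) B A l hAlt hBge hmem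
      have hperm : (A ++ B).Perm l := by
        rw [← h1, ← h2]
        have := List.filter_append_perm (fun x => decide (x < (n₀ + 1))) l
        convert this using 4 with x
        by_cases hx : x < n₀ + 1
        · simp [hx]; omega
        · simp [hx, Nat.le_of_not_lt hx]
      have hlt : ∀ x ∈ l, x < n + 1 := by
        intro x hx
        rcases List.mem_append.1 (hperm.mem_iff.2 hx) with h | h
        · have := hAlt x h
          omega
        · exact hBlt x h
      have hnd : l.Nodup := by
        rw [← hperm.nodup_iff]
        refine hAnd.append hBnd ?_
        intro x hx hy
        have := hAlt x hx
        have := hBge x hy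
        omega
      have hlen : l.length = n + 1 := by
        rw [← hperm.length_eq, List.length_append, hAlen, hBlen]
        omega
      obtain ⟨σ, rfl⟩ := exists_perm_of_list (n + 1) l hlen hnd hlt
      refine ⟨σ, ⟨?_, h1, (hshift _).2 h2, (noAdjLow_iff σ n₀).2 h3⟩, rfl⟩
      rw [listRises_cons_top _ _ (fun x hx => (hlt x hx).le)] at hk
      exact hk
  rw [hcard, gapWords_count (n₀ + 1) B A (n + 1) k hAlt (by omega) hBge,
    listRises_cons_top _ _ (fun x hx => (hBlt x hx).le), hrB, hAlen, hBlen,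
    Nat.cast_sub hn.le]
  push_cast
  rfl
end
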